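/- arXiv:1903.03551 — 3 statements merged into one kernel-verified Lean document; each statement's English description precedes it below -/
import Mathlib

section
/- Let M be a perfect compact metric space, let X = M^ℤ be endowed with the metric r(x,y) = Σ_{n∈ℤ} min{1/(n²+1), d(x_n,y_n)}, and let T be the full shift on X. Then, for each q > 1, the set CD = {μ ∈ M(T) : D⁺_μ(q) = +∞} is a dense G_δ subset of M(T). -/
open MeasureTheory Filter Topology Metric Set
open scoped ENNReal NNReal

section Defs

variable {X : Type*} [MetricSpace X] [MeasurableSpace X]

/-- The topological support of a Borel measure on a metric space: the set of points all of whose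
balls have positive measure. -/
def msupp (μ : Measure X) : Set X := {x : X | ∀ ε > 0, 0 < μ (ball x ε)}

/-- The energy function `I_μ(q, ε) = ∫_{supp μ} μ(B(x,ε))^(q-1) dμ(x)`. -/
noncomputable def energyI (μ : Measure X) (q ε : ℝ) : ℝ :=
  ∫ x in msupp μ, (μ (ball x ε)).toReal ^ (q - 1) ∂μ

/-- The lower `q`-generalized fractal dimension
`D⁻_μ(q) = liminf_{ε→0⁺} log I_μ(q,ε) / ((q-1) log ε)` (as an extended real number). -/
noncomputable def Dlower (μ : Measure X) (q : ℝ) : EReal :=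
  liminf (fun ε : ℝ =>
    ((Real.log (energyI μ q ε) / ((q - 1) * Real.log ε) : ℝ) : EReal)) (𝓝[>] (0 : ℝ))

/-- The upper `q`-generalized fractal dimension
`D⁺_μ(q) = limsup_{ε→0⁺} log I_μ(q,ε) / ((q-1) log ε)` (as an extended real number). -/
noncomputable def Dupper (μ : Measure X) (q : ℝ) : EReal :=
  limsup (fun ε : ℝ =>
    ((Real.log (energyI μ q ε) / ((q - 1) * Real.log ε) : ℝ) : EReal)) (𝓝[>] (0 : ℝ))

/-- `∫_{supp μ} log μ(B(x,ε)) dμ(x)`, the numerator in the entropy dimension. -/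
noncomputable def entNum (μ : Measure X) (ε : ℝ) : ℝ :=
  ∫ x in msupp μ, Real.log (μ (ball x ε)).toReal ∂μ

/-- The lower entropy dimension
`D⁻_μ(1) = liminf_{ε→0⁺} (∫_{supp μ} log μ(B(x,ε)) dμ(x)) / log ε`. -/
noncomputable def D1lower (μ : Measure X) : EReal :=
  liminf (fun ε : ℝ => ((entNum μ ε / Real.log ε : ℝ) : EReal)) (𝓝[>] (0 : ℝ))

/-- The upper entropy dimension
`D⁺_μ(1) = limsup_{ε→0⁺} (∫_{supp μ} log μ(B(x,ε)) dμ(x)) / log ε`. -/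
noncomputable def D1upper (μ : Measure X) : EReal :=
  limsup (fun ε : ℝ => ((entNum μ ε / Real.log ε : ℝ) : EReal)) (𝓝[>] (0 : ℝ))

/-- A measure is `T`-invariant if `μ(T⁻¹ s) = μ s` for every measurable `s`. -/
def IsInvariantMeasure (T : X → X) (μ : Measure X) : Prop :=
  ∀ s : Set X, MeasurableSet s → μ (T ⁻¹' s) = μ s

/-- `M(T)`: the set of `T`-invariant Borel probability measures on `X`. -/
def invSet (T : X → X) : Set (ProbabilityMeasure X) :=
  {μ : ProbabilityMeasure X | IsInvariantMeasure T μ.toMeasure}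

/-- A `T`-periodic measure: `μ = (1/k) ∑_{i<k} δ_{T^i x}` for a `T`-periodic point `x`
of period `k`. -/
def IsPeriodicMeasure (T : X → X) (μ : ProbabilityMeasure X) : Prop :=
  ∃ (x : X) (k : ℕ), 0 < k ∧ T^[k] x = x ∧
    μ.toMeasure = (k : ℝ≥0∞)⁻¹ • ∑ i ∈ Finset.range k, Measure.dirac (T^[i] x)

/-- The upper Hausdorff dimension of a measure:
`dim_H^+(μ) = inf {dimH E | E Borel, μ(X \ E) = 0}`. -/
noncomputable def dimHplus (μ : Measure X) : ℝ≥0∞ :=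
  ⨅ (E : Set X) (_ : MeasurableSet E) (_ : μ Eᶜ = 0), dimH E

/-- The lower Hausdorff dimension of a measure:
`dim_H^-(μ) = inf {dimH E | E Borel, μ(E) > 0}`. -/
noncomputable def dimHminus (μ : Measure X) : ℝ≥0∞ :=
  ⨅ (E : Set X) (_ : MeasurableSet E) (_ : 0 < μ E), dimH E

/-- The return time `τ_s(x) = inf {k ≥ 1 | T^k x ∈ B(x,s)}`. -/
noncomputable def tauRet (T : X → X) (s : ℝ) (x : X) : ℕ :=
  sInf {k : ℕ | 0 < k ∧ T^[k] x ∈ ball x s}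

/-- The lower recurrence rate `R̲(x) = liminf_{s→0⁺} log τ_s(x) / (-log s)`. -/
noncomputable def Rlower (T : X → X) (x : X) : EReal :=
  liminf (fun s : ℝ =>
    ((Real.log (tauRet T s x : ℝ) / (-Real.log s) : ℝ) : EReal)) (𝓝[>] (0 : ℝ))

open Classical in
/-- The lower local dimension `d̲_μ(x) = liminf_{ε→0⁺} log μ(B(x,ε)) / log ε` when all balls
around `x` have positive measure, and `+∞` otherwise. -/
noncomputable def dLoc (μ : Measure X) (x : X) : EReal :=
  if (∀ ε > 0, 0 < μ (ball x ε)) then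
    liminf (fun ε : ℝ =>
      ((Real.log (μ (ball x ε)).toReal / Real.log ε : ℝ) : EReal)) (𝓝[>] (0 : ℝ))
  else ⊤

/-- The auxiliary continuous kernel `f^ε_x(y)`: equal to `1` if `dist x y ≤ ε`, to
`2 - dist x y / ε` if `ε ≤ dist x y ≤ 2ε`, and to `0` if `dist x y ≥ 2ε`. -/
noncomputable def fker (ε : ℝ) (x y : X) : ℝ :=
  if dist x y ≤ ε then 1 else if dist x y ≤ 2 * ε then 2 - dist x y / ε else 0

/-- `f_ε(μ, x) = ∫ f^ε_x(y) dμ(y)`. -/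
noncomputable def feps (ε : ℝ) (μ : Measure X) (x : X) : ℝ := ∫ y, fker ε x y ∂μ

/-- `G` is a finite covering of `X` by open balls of radius `ε` (given by its finite set of
centers). -/
def IsBallCover (ε : ℝ) (G : Finset X) : Prop := (⋃ x ∈ G, ball x ε) = univ

/-- `S_μ(s,ε) = inf_G ∑_{x ∈ G} μ(B(x,ε))^s`, the infimum running over all finite coverings of
`X` by balls of radius `ε`. -/
noncomputable def Sfun (μ : Measure X) (s ε : ℝ) : ℝ :=
  ⨅ G : {H : Finset X // IsBallCover ε H}, ∑ x ∈ G.val, (μ (ball x ε)).toReal ^ s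

/-- `W_μ(s,ε) = inf_G ∑_{x ∈ G} f_ε(μ,x)^s`, the infimum running over all finite coverings of
`X` by balls of radius `ε`. -/
noncomputable def Wfun (μ : Measure X) (s ε : ℝ) : ℝ :=
  ⨅ G : {H : Finset X // IsBallCover ε H}, ∑ x ∈ G.val, (feps ε μ x) ^ s

/-- The regularized energy function `J_μ(q,ε) = ∫ f_ε(μ,x)^(q-1) dμ(x)`. -/
noncomputable def Jfun (μ : Measure X) (q ε : ℝ) : ℝ :=
  ∫ x, (feps ε μ x) ^ (q - 1) ∂μ

end Defs

section Shift

variable {M : Type*} [MetricSpace M]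

/-- The "cylinder ball" `B^n(x,ε) = {y | d(x_i, y_i) < ε for all |i| ≤ n}` in `M^ℤ`. -/
def cylBall (n : ℕ) (x : ℤ → M) (ε : ℝ) : Set (ℤ → M) :=
  {y : ℤ → M | ∀ i : ℤ, |i| ≤ (n : ℤ) → dist (x i) (y i) < ε}

/-- For `ε ∈ (0,1)`, the largest integer `n ≥ 0` with `ε < 1/(n²+1)`. -/
noncomputable def nZero (ε : ℝ) : ℕ := sSup {n : ℕ | ε < 1 / ((n : ℝ) ^ 2 + 1)}

/-- The modified energy function `I^n_μ(q,ε) = ∫ μ(B^n(x,ε))^(q-1) dμ(x)`. -/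
noncomputable def Icyl [MeasurableSpace (ℤ → M)] (μ : Measure (ℤ → M)) (n : ℕ) (q ε : ℝ) :
    ℝ :=
  ∫ x, (μ (cylBall n x ε)).toReal ^ (q - 1) ∂μ

end Shift


section Energy

variable {X : Type*} [MetricSpace X] [MeasurableSpace X]

lemma msupp_eq_support (μ : Measure X) : msupp μ = μ.support := by
  ext x
  exact (nhds_basis_ball.mem_measureSupport (μ := μ) (x := x)).symm

variable [CompactSpace X] [BorelSpace X]

lemma measurable_measure_ball (μ : Measure X) [SFinite μ] (ε : ℝ) :
    Measurable fun x => μ (ball x ε) := by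
  have h : MeasurableSet {p : X × X | dist p.2 p.1 < ε} :=
    measurableSet_lt (by fun_prop) (by fun_prop)
  exact measurable_measure_prodMk_left h

omit [BorelSpace X] in
lemma energyI_eq_integral (μ : Measure X) (q ε : ℝ) :
    energyI μ q ε = ∫ x, (μ (ball x ε)).toReal ^ (q - 1) ∂μ := by
  have h : ∀ᵐ x ∂μ, x ∈ msupp μ := by
    rw [msupp_eq_support]
    exact Measure.support_mem_ae
  rw [energyI, Measure.restrict_eq_self_of_ae_mem h]

omit [BorelSpace X] in
lemma energyI_le (μ : Measure X) [IsProbabilityMeasure μ] {q ε c : ℝ} (hq : 1 < q)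
    (hc : ∀ x, (μ (ball x ε)).toReal ≤ c) : energyI μ q ε ≤ c ^ (q - 1) := by
  rw [energyI_eq_integral]
  have h := norm_setIntegral_le_of_norm_le_const (μ := μ) (s := univ)
    (f := fun x => (μ (ball x ε)).toReal ^ (q - 1)) (C := c ^ (q - 1)) (by simp) (fun x _ => by
      rw [Real.norm_of_nonneg (by positivity)]
      exact Real.rpow_le_rpow (by positivity) (hc x) (by linarith))
  simp only [setIntegral_univ, probReal_univ, mul_one] at h
  exact (le_abs_self _).trans h

lemma rpow_measure_ball_le_energyI (μ : Measure X) [IsProbabilityMeasure μ] {q : ℝ} (hq : 1 < q)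
    (ε : ℝ) (y : X) : (μ (ball y (ε / 2))).toReal ^ q ≤ energyI μ q ε := by
  rw [energyI_eq_integral]
  have hint : Integrable (fun x => (μ (ball x ε)).toReal ^ (q - 1)) μ := by
    refine Integrable.of_bound
      ((measurable_measure_ball μ ε).ennreal_toReal.pow_const _).aestronglyMeasurable 1
      (Eventually.of_forall fun x => ?_)
    rw [Real.norm_of_nonneg (by positivity)]
    exact Real.rpow_le_one (by positivity) measureReal_le_one (by linarith)
  set c := (μ (ball y (ε / 2))).toReal
  have hle : ∀ x, (ball y (ε / 2)).indicator (fun _ => c ^ (q - 1)) x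
      ≤ (μ (ball x ε)).toReal ^ (q - 1) := by
    intro x
    by_cases hx : x ∈ ball y (ε / 2)
    · rw [indicator_of_mem hx]
      refine Real.rpow_le_rpow ENNReal.toReal_nonneg (measureReal_mono fun z hz => ?_)
        (by linarith)
      have h1 := dist_triangle_right z x y
      simp only [mem_ball] at hx hz ⊢
      linarith
    · rw [indicator_of_notMem hx]
      positivity
  have h := integral_mono ((integrable_const _).indicator measurableSet_ball) hint hle
  rw [integral_indicator measurableSet_ball, setIntegral_const, smul_eq_mul] at h
  refine le_trans (le_of_eq ?_) h
  change c ^ q = c * _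
  rw [← Real.rpow_one_add' ENNReal.toReal_nonneg (by linarith), add_sub_cancel]

lemma energyI_pos (μ : Measure X) [IsProbabilityMeasure μ] {q ε : ℝ} (hq : 1 < q) (hε : 0 < ε) :
    0 < energyI μ q ε := by
  obtain ⟨y, hy⟩ := Measure.nonempty_support (IsProbabilityMeasure.ne_zero μ)
  rw [← msupp_eq_support] at hy
  refine lt_of_lt_of_le ?_ (rpow_measure_ball_le_energyI μ hq ε y)
  exact Real.rpow_pos_of_pos
    (ENNReal.toReal_pos (hy _ (half_pos hε)).ne' (measure_ne_top _ _)) _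

lemma Dupper_eq_top_of_frequently (μ : Measure X) [IsProbabilityMeasure μ] {q : ℝ} (hq : 1 < q)
    (h : ∀ k : ℕ, ∃ᶠ ε in 𝓝[>] (0 : ℝ), ∀ x, (μ (ball x ε)).toReal ≤ ε ^ k) :
    Dupper μ q = ⊤ := by
  rw [EReal.eq_top_iff_forall_lt]
  intro K
  obtain ⟨k, hk⟩ := exists_nat_gt K
  refine lt_of_lt_of_le (EReal.coe_lt_coe_iff.2 hk) (le_limsup_of_frequently_le' ?_)
  have hev : ∀ᶠ ε in 𝓝[>] (0 : ℝ), ε ∈ Ioo (0 : ℝ) 1 := Ioo_mem_nhdsGT one_pos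
  refine ((h k).and_eventually hev).mono ?_
  rintro ε ⟨hε, h0, h1⟩
  have hlog : Real.log ε < 0 := Real.log_neg h0 h1
  rw [EReal.coe_le_coe_iff, le_div_iff_of_neg (mul_neg_of_pos_of_neg (by linarith) hlog)]
  refine (Real.log_le_log (energyI_pos μ hq h0) (energyI_le μ hq hε)).trans (le_of_eq ?_)
  rw [Real.log_rpow (by positivity), Real.log_pow]
  ring

lemma frequently_of_Dupper_eq_top (μ : Measure X) [IsProbabilityMeasure μ] {q : ℝ} (hq : 1 < q)
    (h : Dupper μ q = ⊤) (K : ℝ) :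
    ∃ᶠ ε in 𝓝[>] (0 : ℝ), ∀ x, (μ (ball x (ε / 2))).toReal < ε ^ K := by
  have hlt : ((K * q / (q - 1) : ℝ) : EReal) < Dupper μ q := h ▸ EReal.coe_lt_top _
  have hev : ∀ᶠ ε in 𝓝[>] (0 : ℝ), ε ∈ Ioo (0 : ℝ) 1 := Ioo_mem_nhdsGT one_pos
  refine ((frequently_lt_of_lt_limsup (by isBoundedDefault) hlt).and_eventually hev).mono ?_
  rintro ε ⟨hε, h0, h1⟩ x
  have hlog : Real.log ε < 0 := Real.log_neg h0 h1
  have hq' : q - 1 ≠ 0 := by linarith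
  rw [EReal.coe_lt_coe_iff, lt_div_iff_of_neg (mul_neg_of_pos_of_neg (by linarith) hlog)] at hε
  have hI : energyI μ q ε < (ε ^ K) ^ q := by
    rw [← Real.log_lt_log_iff (energyI_pos μ hq h0) (by positivity), ← Real.rpow_mul h0.le,
      Real.log_rpow h0]
    refine hε.trans_eq ?_
    field_simp
  exact (Real.rpow_lt_rpow_iff ENNReal.toReal_nonneg (by positivity) (by linarith)).1
    ((rpow_measure_ball_le_energyI μ hq ε x).trans_lt hI)

omit [CompactSpace X] in
lemma isOpen_setOf_measure_lt {F : Set X} (hF : IsClosed F) (c : ℝ≥0∞) :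
    IsOpen {μ : ProbabilityMeasure X | μ.toMeasure F < c} := by
  rw [isOpen_iff_mem_nhds]
  intro μ hμ
  exact eventually_lt_of_limsup_lt
    ((ProbabilityMeasure.limsup_measure_closed_le_of_tendsto tendsto_id hF).trans_lt hμ)

lemma isGδ_setOf_Dupper_eq_top {q : ℝ} (hq : 1 < q) :
    IsGδ {μ : ProbabilityMeasure X | Dupper μ.toMeasure q = ⊤} := by
  have hnet : ∀ ε : ℝ, ∃ F : Set X, F.Finite ∧ (0 < ε → univ ⊆ ⋃ y ∈ F, ball y ε) := by
    intro ε
    by_cases hε : 0 < ε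
    · obtain ⟨F, -, hF, hcov⟩ := finite_cover_balls_of_compact (isCompact_univ (X := X)) hε
      exact ⟨F, hF, fun _ => hcov⟩
    · exact ⟨∅, finite_empty, fun h => absurd h hε⟩
  choose F hfin hcov using hnet
  have key : {μ : ProbabilityMeasure X | Dupper μ.toMeasure q = ⊤} =
      ⋂ (k : ℕ) (n : ℕ), ⋃ ε ∈ Ioo (0 : ℝ) (1 / (n + 1)), ⋂ y ∈ F ε,
        {μ | μ.toMeasure (closedBall y (2 * ε)) < ENNReal.ofReal (ε ^ k)} := by
    ext μ
    simp only [mem_ofPred_eq, mem_iInter, mem_iUnion, exists_prop]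
    constructor
    · intro h k n
      have hev : ∀ᶠ ε in 𝓝[>] (0 : ℝ), ε ∈ Ioo (0 : ℝ) (min (1 / 5) (1 / (n + 1))) :=
        Ioo_mem_nhdsGT (by positivity)
      obtain ⟨ε, hε, h0, h1⟩ :=
        ((frequently_of_Dupper_eq_top μ.toMeasure hq h (2 * k : ℕ)).and_eventually hev).exists
      obtain ⟨h2, h3⟩ := lt_min_iff.1 h1
      refine ⟨ε / 5, ⟨by positivity, by linarith⟩, fun y _ => ?_⟩
      rw [← ENNReal.ofReal_toReal (measure_ne_top μ.toMeasure (closedBall y (2 * (ε / 5)))),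
        ENNReal.ofReal_lt_ofReal_iff (by positivity)]
      have hball : (μ.toMeasure (closedBall y (2 * (ε / 5)))).toReal
          ≤ (μ.toMeasure (ball y (ε / 2))).toReal :=
        measureReal_mono (closedBall_subset_ball (by linarith))
      refine (hball.trans_lt (hε y)).trans_le ?_
      rw [Real.rpow_natCast, pow_mul]
      exact pow_le_pow_left₀ (by positivity) (by nlinarith) k
    · intro h
      refine Dupper_eq_top_of_frequently _ hq fun k => ?_
      rw [(nhdsGT_basis (0 : ℝ)).frequently_iff]
      intro a ha
      obtain ⟨n, hn⟩ := exists_nat_one_div_lt ha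
      obtain ⟨ε, ⟨h0, h1⟩, hε⟩ := h k n
      refine ⟨ε, ⟨h0, h1.trans hn⟩, fun x => ?_⟩
      obtain ⟨y, hy, hxy⟩ := mem_iUnion₂.1 (hcov ε h0 (mem_univ x))
      refine ENNReal.toReal_le_of_le_ofReal (by positivity) ?_
      refine (measure_mono fun z hz => ?_).trans (hε y hy).le
      have h4 := dist_triangle z x y
      simp only [mem_ball, mem_closedBall] at hxy hz ⊢
      linarith
  rw [key]
  refine .iInter fun k => .iInter fun n => IsOpen.isGδ ?_
  exact isOpen_biUnion fun ε _ => (hfin ε).isOpen_biInter fun y _ =>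
    isOpen_setOf_measure_lt isClosed_closedBall _

end Energy

section Perturbation

variable {M : Type*} [MetricSpace M]

lemma exists_separated_displacements [CompactSpace M] [MeasurableSpace M] [BorelSpace M]
    (hperf : Perfect (univ : Set M)) {δ : ℝ} (hδ : 0 < δ) :
    ∃ f : Bool → M → M, (∀ b, Measurable (f b)) ∧ (∀ b x, dist (f b x) x < δ) ∧
      ∃ η > 0, ∀ x, η ≤ dist (f true x) (f false x) := by
  rcases isEmpty_or_nonempty M with hM | hM
  · exact ⟨fun _ => id, fun _ => measurable_id, fun _ => isEmptyElim, 1, one_pos, isEmptyElim⟩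
  have hg : ∀ z : M, ∃ y, dist y z < δ / 2 ∧ y ≠ z := fun z => by
    obtain ⟨y, hy, hne⟩ := preperfect_iff_nhds.1 hperf.acc z (mem_univ z) _
      (ball_mem_nhds z (half_pos hδ))
    exact ⟨y, hy.1, hne⟩
  choose g hgd hgne using hg
  set e := TopologicalSpace.denseSeq M
  obtain ⟨t, ht⟩ := (isCompact_univ (X := M)).elim_finite_subcover
    (fun n => ball (e n) (δ / 2)) (fun _ => isOpen_ball) (fun x _ => by
      obtain ⟨_, ⟨n, rfl⟩, hn⟩ := Metric.mem_closure_iff.1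
        (TopologicalSpace.denseRange_denseSeq M x) _ (half_pos hδ)
      exact mem_iUnion.2 ⟨n, hn⟩)
  obtain ⟨N, hN⟩ := t.exists_le
  set s := SimpleFunc.nearestPt e N
  have hs : ∀ x, dist (s x) x < δ / 2 := fun x => by
    obtain ⟨n, hn, hx⟩ := mem_iUnion₂.1 (ht (mem_univ x))
    have h := SimpleFunc.edist_nearestPt_le e x (hN n hn)
    rw [edist_dist, edist_dist, ENNReal.ofReal_le_ofReal_iff dist_nonneg] at h
    exact h.trans_lt (by rwa [dist_comm])
  obtain ⟨η, hη, hη0⟩ : ∃ η, (∀ z ∈ s.range, η < dist z (g z)) ∧ 0 < η := by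
    have h : ∀ᶠ η in 𝓝[>] (0 : ℝ), ∀ z ∈ s.range, η < dist z (g z) :=
      (Filter.eventually_all_finset _).2 fun z _ => nhdsWithin_le_nhds
        (eventually_lt_nhds (dist_pos.2 (hgne z).symm))
    exact (h.and self_mem_nhdsWithin).exists
  refine ⟨fun b => bif b then s else s.map g, ?_, ?_, η, hη0, fun x => ?_⟩
  · rintro (_ | _)
    exacts [(s.map g).measurable, s.measurable]
  · rintro (_ | _) x
    · have h1 := dist_triangle (g (s x)) (s x) x
      have h2 := hgd (s x)
      have h3 := hs x
      simp only [cond_false, SimpleFunc.map_apply]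
      linarith
    · exact (hs x).trans (half_lt_self hδ)
  · simpa using (hη (s x) (s.mem_range_self x)).le

/-- The law of i.i.d. fair coin flips indexed by `ℤ`. -/
noncomputable def coinMeasure : Measure (ℤ → Bool) :=
  Measure.infinitePi fun _ => (PMF.uniformOfFintype Bool).toMeasure

instance : IsProbabilityMeasure coinMeasure := by
  unfold coinMeasure
  infer_instance

lemma coinMeasure_pi_singleton (s : Finset ℤ) (a : ℤ → Bool) :
    coinMeasure ((s : Set ℤ).pi fun n => {a n}) = 2⁻¹ ^ s.card := by
  rw [coinMeasure, Measure.infinitePi_pi _ fun _ _ => measurableSet_singleton _]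
  simp

lemma measurePreserving_shift_coinMeasure :
    MeasurePreserving (fun (ω : ℤ → Bool) i => ω (i - 1)) coinMeasure coinMeasure := by
  refine ⟨by fun_prop, ?_⟩
  have h := Measure.infinitePi_map_piCongrLeft (X := fun _ : ℤ => Bool)
    (fun _ => (PMF.uniformOfFintype Bool).toMeasure) (Equiv.addRight (1 : ℤ))
  refine Eq.trans ?_ h
  rw [coinMeasure]
  congr 1
  ext ω i
  have := Equiv.piCongrLeft_apply_apply (fun _ : ℤ => Bool) (Equiv.addRight (1 : ℤ)) ω (i - 1)
  simpa [MeasurableEquiv.coe_piCongrLeft] using this.symm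

/-- Apply at each site `n` the displacement `f (ω n)` selected by the `n`-th coin. -/
def perturb (f : Bool → M → M) (p : (ℤ → M) × (ℤ → Bool)) : ℤ → M := fun n => f (p.2 n) (p.1 n)

variable [MeasurableSpace M]

omit [MetricSpace M] in
lemma measurable_perturb {f : Bool → M → M} (hf : ∀ b, Measurable (f b)) :
    Measurable (perturb f) := by
  refine measurable_pi_lambda _ fun n => ?_
  have h : Measurable fun p : Bool × M => f p.1 p.2 := measurable_from_prod_countable_right hf
  exact h.comp (by fun_prop : Measurable fun p : (ℤ → M) × (ℤ → Bool) => (p.2 n, p.1 n))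

omit [MetricSpace M] in
lemma isInvariantMeasure_map_perturb [MetricSpace (ℤ → M)] {T : (ℤ → M) → (ℤ → M)}
    (hT : ∀ x i, T x i = x (i - 1)) {f : Bool → M → M} (hf : ∀ b, Measurable (f b))
    {μ : Measure (ℤ → M)} [IsProbabilityMeasure μ] (hμ : IsInvariantMeasure T μ) :
    IsInvariantMeasure T ((μ.prod coinMeasure).map (perturb f)) := by
  have hTm : Measurable T := measurable_pi_lambda _ fun i => by
    simp only [hT]
    fun_prop
  have hTp : MeasurePreserving T μ μ :=
    ⟨hTm, Measure.ext fun s hs => by rw [Measure.map_apply hTm hs, hμ s hs]⟩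
  have hprod := hTp.prod measurePreserving_shift_coinMeasure
  have hm := measurable_perturb hf
  intro s hs
  rw [Measure.map_apply hm hs, Measure.map_apply hm (hTm hs),
    ← hprod.measure_preimage (hm hs).nullMeasurableSet]
  congr 1
  ext p
  have : T (perturb f p) = perturb f (Prod.map T (fun ω i => ω (i - 1)) p) := by
    ext i
    simp [perturb, hT]
  simp [this]

lemma map_perturb_pi_ball_le [OpensMeasurableSpace M] {f : Bool → M → M}
    (hf : ∀ b, Measurable (f b)) {η ε : ℝ} (hη : ∀ x, η ≤ dist (f true x) (f false x))
    (hε : 2 * ε ≤ η) (μ : Measure (ℤ → M)) [IsProbabilityMeasure μ] (s : Finset ℤ) (x : ℤ → M) :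
    (μ.prod coinMeasure).map (perturb f) ((s : Set ℤ).pi fun n => ball (x n) ε)
      ≤ 2⁻¹ ^ s.card := by
  have hs : MeasurableSet ((s : Set ℤ).pi fun n => ball (x n) ε) :=
    MeasurableSet.pi s.countable_toSet fun _ _ => measurableSet_ball
  rw [Measure.map_apply (measurable_perturb hf) hs,
    Measure.prod_apply (measurable_perturb hf hs)]
  refine (lintegral_mono (g := fun _ => 2⁻¹ ^ s.card) fun y => ?_).trans (by simp)
  classical
  rw [← coinMeasure_pi_singleton s fun n => decide (dist (f true (y n)) (x n) < ε)]
  refine measure_mono fun ω hω n hn => ?_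
  have h : dist (f (ω n) (y n)) (x n) < ε := hω n hn
  have h2 := dist_triangle_right (f true (y n)) (f false (y n)) (x n)
  have h3 := hη (y n)
  rw [mem_singleton_iff]
  cases hb : ω n <;> rw [hb] at h
  · exact (decide_eq_false (by linarith)).symm
  · exact (decide_eq_true h).symm

end Perturbation

section Shift

variable {M : Type*} [MetricSpace M] {mX : MetricSpace (ℤ → M)}

lemma summable_one_div_int_sq_add_one : Summable fun n : ℤ => 1 / ((n : ℝ) ^ 2 + 1) := by
  refine Summable.of_norm_bounded_eventually (g := fun n : ℤ => 1 / (n : ℝ) ^ 2)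
    (Real.summable_one_div_int_pow.2 one_lt_two) ?_
  filter_upwards [(finite_singleton (0 : ℤ)).compl_mem_cofinite] with n hn
  have hn : (n : ℝ) ≠ 0 := by exact_mod_cast hn
  rw [Real.norm_of_nonneg (by positivity)]
  gcongr
  linarith

lemma ball_subset_pi_ball
    (hr : ∀ x y : ℤ → M,
      dist x y = ∑' n : ℤ, min (1 / ((n : ℝ) ^ 2 + 1)) (dist (x n) (y n)))
    (x : ℤ → M) {ε : ℝ} {s : Set ℤ} (hs : ∀ n ∈ s, ε ≤ 1 / ((n : ℝ) ^ 2 + 1)) :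
    ball x ε ⊆ s.pi fun n => ball (x n) ε := by
  intro y hy n hn
  rw [mem_ball, hr] at hy
  have h0 : ∀ n : ℤ, 0 ≤ min (1 / ((n : ℝ) ^ 2 + 1)) (dist (y n) (x n)) := fun n => by positivity
  have h1 := (Summable.of_nonneg_of_le h0 (fun n => min_le_left _ _)
    summable_one_div_int_sq_add_one).le_tsum n fun m _ => h0 m
  exact (min_lt_iff.1 (h1.trans_lt hy)).resolve_left (hs n hn).not_gt

lemma topology_eq_induced_of_continuous_dist {Y Z : Type*} [TopologicalSpace Y] [CompactSpace Y]
    [MetricSpace Z] (e : Y ≃ Z) (h : ∀ z, Continuous fun y => dist (e y) z) :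
    ‹TopologicalSpace Y› = TopologicalSpace.induced e UniformSpace.toTopologicalSpace := by
  have hc : Continuous e := continuous_iff_continuousAt.2 fun x =>
    tendsto_iff_dist_tendsto_zero.2 (by simpa using (h (e x)).tendsto x)
  exact hc.homeoOfEquivCompactToT2.isInducing.eq_induced

lemma pi_topology_eq_of_dist_eq_tsum [CompactSpace M]
    (hr : ∀ x y : ℤ → M,
      dist x y = ∑' n : ℤ, min (1 / ((n : ℝ) ^ 2 + 1)) (dist (x n) (y n))) :
    (Pi.topologicalSpace : TopologicalSpace (ℤ → M)) =
      mX.toPseudoMetricSpace.toUniformSpace.toTopologicalSpace := by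
  refine (topology_eq_induced_of_continuous_dist (Equiv.refl (ℤ → M)) fun x => ?_).trans
    (@induced_id _ mX.toPseudoMetricSpace.toUniformSpace.toTopologicalSpace)
  simp only [hr, Equiv.refl_apply]
  refine continuous_tsum (fun n => by fun_prop) summable_one_div_int_sq_add_one fun n y => ?_
  rw [Real.norm_of_nonneg (by positivity)]
  exact min_le_left _ _

lemma isGδ_setOf_Dupper_eq_top_of_topology_eq {X : Type*} [t : TopologicalSpace X]
    {m : MetricSpace X} (h : t = m.toPseudoMetricSpace.toUniformSpace.toTopologicalSpace)
    [CompactSpace X] [MeasurableSpace X] [BorelSpace X] {q : ℝ} (hq : 1 < q) :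
    IsGδ {μ : ProbabilityMeasure X | Dupper μ.toMeasure q = ⊤} := by
  subst h
  exact isGδ_setOf_Dupper_eq_top hq

lemma Dupper_eq_top_of_frequently_of_topology_eq {X : Type*} [t : TopologicalSpace X]
    {m : MetricSpace X} (h : t = m.toPseudoMetricSpace.toUniformSpace.toTopologicalSpace)
    [CompactSpace X] [MeasurableSpace X] [BorelSpace X] (μ : Measure X) [IsProbabilityMeasure μ]
    {q : ℝ} (hq : 1 < q)
    (hμ : ∀ k : ℕ, ∃ᶠ ε in 𝓝[>] (0 : ℝ), ∀ x, (μ (ball x ε)).toReal ≤ ε ^ k) :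
    Dupper μ q = ⊤ := by
  subst h
  exact Dupper_eq_top_of_frequently μ hq hμ

lemma eventually_half_pow_le (k : ℕ) :
    ∀ᶠ N : ℕ in atTop, (2⁻¹ : ℝ) ^ N ≤ (1 / ((N : ℝ) ^ 2 + 1)) ^ k := by
  have h := (tendsto_pow_const_div_const_pow_of_one_lt (3 * k) one_lt_two).eventually_lt_const
    one_pos
  filter_upwards [h, eventually_ge_atTop 2] with N hN hN2
  have hN2 : (2 : ℝ) ≤ N := by exact_mod_cast hN2
  rw [div_lt_one (by positivity), pow_mul] at hN
  rw [inv_pow, one_div, inv_pow]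
  gcongr
  refine le_trans ?_ hN.le
  gcongr
  nlinarith

lemma Dupper_map_perturb_eq_top [CompactSpace M] [MeasurableSpace M] [BorelSpace M]
    (hr : ∀ x y : ℤ → M,
      dist x y = ∑' n : ℤ, min (1 / ((n : ℝ) ^ 2 + 1)) (dist (x n) (y n)))
    {f : Bool → M → M} (hf : ∀ b, Measurable (f b)) {η : ℝ} (hη0 : 0 < η)
    (hη : ∀ x, η ≤ dist (f true x) (f false x)) (μ : Measure (ℤ → M)) [IsProbabilityMeasure μ]
    {q : ℝ} (hq : 1 < q) :
    Dupper ((μ.prod coinMeasure).map (perturb f)) q = ⊤ := by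
  have : IsProbabilityMeasure ((μ.prod coinMeasure).map (perturb f)) :=
    Measure.isProbabilityMeasure_map (measurable_perturb hf).aemeasurable
  refine Dupper_eq_top_of_frequently_of_topology_eq (pi_topology_eq_of_dist_eq_tsum hr) _ hq
    fun k => ?_
  have hlim : Tendsto (fun N : ℕ => 1 / ((N : ℝ) ^ 2 + 1)) atTop (𝓝[>] 0) := by
    refine tendsto_nhdsWithin_iff.2 ⟨?_, Eventually.of_forall fun N => by
      simp only [mem_Ioi]; positivity⟩
    simp only [one_div]
    exact ((tendsto_pow_atTop two_ne_zero).comp tendsto_natCast_atTop_atTop).atTop_add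
      tendsto_const_nhds |>.inv_tendsto_atTop
  have hsmall : ∀ᶠ ε in 𝓝[>] (0 : ℝ), 2 * ε ≤ η := by
    filter_upwards [Ioo_mem_nhdsGT (half_pos hη0)] with ε hε
    linarith [hε.2]
  refine hlim.frequently (Eventually.frequently ?_)
  filter_upwards [eventually_half_pow_le k, hlim.eventually hsmall] with N hN hN2 x
  refine le_trans ?_ hN
  have hsub := ball_subset_pi_ball hr x (s := (Finset.Ico (0 : ℤ) N : Finset ℤ))
    (ε := 1 / ((N : ℝ) ^ 2 + 1)) fun n hn => by
      obtain ⟨h0, h1⟩ := Finset.mem_Ico.1 hn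
      have h0 : (0 : ℝ) ≤ n := by exact_mod_cast h0
      have h1 : (n : ℝ) ≤ N := by exact_mod_cast h1.le
      gcongr
  have h := (measure_mono hsub).trans
    (map_perturb_pi_ball_le hf hη hN2 μ (Finset.Ico (0 : ℤ) N) x)
  simpa using ENNReal.toReal_mono (by simp) h

lemma dense_setOf_Dupper_eq_top [CompactSpace M] (hperf : Perfect (univ : Set M))
    [MeasurableSpace M] [BorelSpace M]
    (hr : ∀ x y : ℤ → M,
      dist x y = ∑' n : ℤ, min (1 / ((n : ℝ) ^ 2 + 1)) (dist (x n) (y n)))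
    {T : (ℤ → M) → (ℤ → M)} (hT : ∀ x i, T x i = x (i - 1)) {q : ℝ} (hq : 1 < q) :
    Dense {μ : ↥(invSet T) | Dupper μ.val.toMeasure q = (⊤ : EReal)} := by
  intro μ
  choose f hf hfd η hη0 hη using fun k : ℕ =>
    exists_separated_displacements hperf (Nat.one_div_pos_of_nat (α := ℝ) (n := k))
  have hlim : ∀ p : (ℤ → M) × (ℤ → Bool),
      Tendsto (fun k => perturb (f k) p) atTop (𝓝 p.1) := fun p => by
    refine tendsto_pi_nhds.2 fun n => tendsto_iff_dist_tendsto_zero.2 ?_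
    exact squeeze_zero (fun _ => dist_nonneg) (fun k => (hfd k _ _).le)
      tendsto_one_div_add_atTop_nhds_zero_nat
  have hdist := (tendstoInDistribution_of_ae_tendsto (μ' := μ.val.toMeasure.prod coinMeasure)
    (fun k => (measurable_perturb (hf k)).aemeasurable) measurable_fst.aemeasurable
    (Eventually.of_forall hlim)).tendsto
  have hfst : (⟨(μ.val.toMeasure.prod coinMeasure).map Prod.fst,
      Measure.isProbabilityMeasure_map measurable_fst.aemeasurable⟩ :
      ProbabilityMeasure (ℤ → M)) = μ.val :=
    Subtype.ext (by simp [Measure.map_fst_prod])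
  rw [hfst] at hdist
  refine mem_closure_of_tendsto (b := atTop) (f := fun k => (⟨_,
    isInvariantMeasure_map_perturb hT (hf k) μ.2⟩ : ↥(invSet T)))
    (tendsto_subtype_rng.2 hdist) (Eventually.of_forall fun k => ?_)
  exact Dupper_map_perturb_eq_top hr (hf k) (hη0 k) (hη k) _ hq

end Shift

/-- For the full shift on `X = M^ℤ` (with `M` perfect compact metric, `X`
bearing the metric `r(x,y) = ∑_{n∈ℤ} min (1/(n²+1)) (d(xₙ,yₙ))`), for each `q > 1` the set
`CD = {μ ∈ M(T) | D⁺_μ(q) = +∞}` is a dense `G_δ` subset of `M(T)`. -/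
theorem statement3 {M : Type*} [MetricSpace M] [CompactSpace M]
    (hperf : Perfect (Set.univ : Set M))
    [mX : MetricSpace (ℤ → M)]
    (hr : ∀ x y : ℤ → M,
      dist x y = ∑' n : ℤ, min (1 / ((n : ℝ) ^ 2 + 1)) (dist (x n) (y n)))
    [MeasurableSpace (ℤ → M)] [BorelSpace (ℤ → M)]
    (T : (ℤ → M) → (ℤ → M)) (hT : ∀ (x : ℤ → M) (i : ℤ), T x i = x (i - 1))
    (q : ℝ) (hq : 1 < q) :
    IsGδ {μ : ↥(invSet T) | Dupper μ.val.toMeasure q = (⊤ : EReal)} ∧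
    Dense {μ : ↥(invSet T) | Dupper μ.val.toMeasure q = (⊤ : EReal)} := by
  have hpi : ‹MeasurableSpace (ℤ → M)› = @MeasurableSpace.pi ℤ (fun _ => M) fun _ => borel M := by
    borelize M
    exact (BorelSpace.measurable_eq (α := ℤ → M)).trans Pi.borelSpace.measurable_eq.symm
  borelize M
  subst hpi
  exact ⟨(isGδ_setOf_Dupper_eq_top_of_topology_eq (pi_topology_eq_of_dist_eq_tsum hr) hq).preimage
    continuous_subtype_val, dense_setOf_Dupper_eq_top hperf hr hT hq⟩
end

section
/- Let M be a perfect compact metric space, let X = M^ℤ be endowed with the metric r(x,y) = Σ_{n∈ℤ} min{1/(n²+1), d(x_n,y_n)}, and let T be the full shift on X. Then the set ED_− = {μ ∈ M(T) : D⁻_μ(1) = 0} is a residual subset of M(T). -/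
open MeasureTheory Filter Topology Metric Set
open scoped ENNReal NNReal

section EntropyBound

variable {X : Type*} [MetricSpace X] [MeasurableSpace X]

lemma lintegral_inv_measure_ball_le [OpensMeasurableSpace X] (μ : Measure X) (F : Finset X)
    (ε : ℝ) :
    ∫⁻ x in ⋃ c ∈ F, ball c (ε / 2), (μ (ball x ε))⁻¹ ∂μ ≤ F.card := by
  classical
  induction F using Finset.induction_on with
  | empty => simp
  | insert c F hc ih =>
    rw [Finset.set_biUnion_insert, Finset.card_insert_of_notMem hc]
    refine (lintegral_union_le _ _ _).trans ?_
    rw [Nat.cast_add, add_comm]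
    refine add_le_add ih ?_
    calc ∫⁻ x in ball c (ε / 2), (μ (ball x ε))⁻¹ ∂μ
        ≤ ∫⁻ _ in ball c (ε / 2), (μ (ball c (ε / 2)))⁻¹ ∂μ := by
          refine setLIntegral_mono' measurableSet_ball fun x hx => ?_
          refine ENNReal.inv_le_inv.2 (measure_mono (ball_subset_ball' ?_))
          rw [mem_ball, dist_comm] at hx
          linarith
      _ ≤ ((1 : ℕ) : ℝ≥0∞) := by
          rw [setLIntegral_const, Nat.cast_one]
          exact ENNReal.inv_mul_le_one _

lemma ofReal_neg_log_toReal_le {t : ℝ≥0∞} (ht : t ≤ 1) {a : ℝ} (ha : 1 ≤ a) :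
    ENNReal.ofReal (-Real.log t.toReal) ≤
      ENNReal.ofReal (Real.log a) + ENNReal.ofReal a⁻¹ * t⁻¹ := by
  rcases eq_or_ne t 0 with rfl | h0
  · simp
  have htop : t ≠ ⊤ := ne_top_of_le_ne_top ENNReal.one_ne_top ht
  have hs : 0 < t.toReal := ENNReal.toReal_pos h0 htop
  have ha0 : 0 < a := by linarith
  have hlog : -Real.log t.toReal ≤ Real.log a + a⁻¹ * t.toReal⁻¹ := by
    have h := Real.log_le_sub_one_of_pos (show 0 < a⁻¹ * t.toReal⁻¹ by positivity)
    rw [Real.log_mul (by positivity) (by positivity), Real.log_inv, Real.log_inv] at h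
    linarith
  have ht' : t⁻¹ = ENNReal.ofReal t.toReal⁻¹ := by
    rw [ENNReal.ofReal_inv_of_pos hs, ENNReal.ofReal_toReal htop]
  rw [ht', ← ENNReal.ofReal_mul (by positivity),
    ← ENNReal.ofReal_add (Real.log_nonneg ha) (by positivity)]
  exact ENNReal.ofReal_le_ofReal hlog

lemma setLIntegral_neg_log_measure_ball_le [OpensMeasurableSpace X] (μ : Measure X)
    [IsProbabilityMeasure μ] {F : Finset X} (hF : F.Nonempty) {ε : ℝ} {s : Set X}
    (hs : s ⊆ ⋃ c ∈ F, ball c (ε / 2)) :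
    ∫⁻ x in s, ENNReal.ofReal (-Real.log (μ (ball x ε)).toReal) ∂μ ≤
      ENNReal.ofReal (Real.log F.card) * μ s + 1 := by
  have hcard : (1 : ℝ) ≤ F.card := by exact_mod_cast hF.card_pos
  calc ∫⁻ x in s, ENNReal.ofReal (-Real.log (μ (ball x ε)).toReal) ∂μ
      ≤ ∫⁻ x in s, (ENNReal.ofReal (Real.log F.card) +
          ENNReal.ofReal ((F.card : ℝ)⁻¹) * (μ (ball x ε))⁻¹) ∂μ :=
        lintegral_mono fun x => ofReal_neg_log_toReal_le prob_le_one hcard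
    _ = ENNReal.ofReal (Real.log F.card) * μ s +
          ENNReal.ofReal ((F.card : ℝ)⁻¹) * ∫⁻ x in s, (μ (ball x ε))⁻¹ ∂μ := by
        rw [lintegral_add_left measurable_const, setLIntegral_const,
          lintegral_const_mul' _ _ ENNReal.ofReal_ne_top]
    _ ≤ ENNReal.ofReal (Real.log F.card) * μ s +
          ENNReal.ofReal ((F.card : ℝ)⁻¹) * F.card := by
        gcongr
        exact (lintegral_mono_set hs).trans (lintegral_inv_measure_ball_le μ F ε)
    _ = ENNReal.ofReal (Real.log F.card) * μ s + 1 := by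
        rw [ENNReal.ofReal_inv_of_pos (by linarith), ENNReal.ofReal_natCast,
          ENNReal.inv_mul_cancel (by exact_mod_cast hF.card_pos.ne') (ENNReal.natCast_ne_top _)]

lemma neg_entNum_le_of_lintegral_le (μ : Measure X) [IsProbabilityMeasure μ] {ε C : ℝ}
    (hC : 0 ≤ C)
    (h : ∫⁻ x, ENNReal.ofReal (-Real.log (μ (ball x ε)).toReal) ∂μ ≤ ENNReal.ofReal C) :
    -entNum μ ε ≤ C := by
  rw [entNum, ← integral_neg]
  by_cases hi : Integrable (fun x => -Real.log (μ (ball x ε)).toReal) (μ.restrict (msupp μ))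
  · rw [integral_eq_lintegral_of_nonneg_ae _ hi.aestronglyMeasurable]
    · exact ENNReal.toReal_le_of_le_ofReal hC ((setLIntegral_le_lintegral _ _).trans h)
    · refine Eventually.of_forall fun x => neg_nonneg.2 ?_
      exact Real.log_nonpos ENNReal.toReal_nonneg
        (ENNReal.toReal_le_of_le_ofReal zero_le_one (by simpa using prob_le_one))
  · rwa [integral_undef hi]

lemma entNum_nonpos (μ : Measure X) [IsProbabilityMeasure μ] (ε : ℝ) : entNum μ ε ≤ 0 :=
  integral_nonpos fun _ => Real.log_nonpos ENNReal.toReal_nonneg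
    (ENNReal.toReal_le_of_le_ofReal zero_le_one (by simpa using prob_le_one))

lemma D1lower_eq_zero (μ : Measure X) [IsProbabilityMeasure μ]
    (h : ∀ n : ℕ, ∃ ε ∈ Ioo (0 : ℝ) (1 / (n + 1)),
      entNum μ ε / Real.log ε ≤ 1 / ((n : ℝ) + 1)) :
    D1lower μ = 0 := by
  refine le_antisymm ?_ ?_
  · refine EReal.le_of_forall_lt_iff_le.1 fun δ hδ => ?_
    have hδ' : 0 < δ := by exact_mod_cast hδ
    refine liminf_le_of_frequently_le' ?_
    rw [frequently_iff]
    intro U hU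
    obtain ⟨u, hu, hUu⟩ := mem_nhdsGT_iff_exists_Ioo_subset.1 hU
    obtain ⟨n, hn⟩ := exists_nat_one_div_lt (lt_min hδ' (show (0 : ℝ) < u from hu))
    obtain ⟨ε, hε, hle⟩ := h n
    refine ⟨ε, hUu ⟨hε.1, hε.2.trans (hn.trans_le (min_le_right _ _))⟩, ?_⟩
    exact EReal.coe_le_coe_iff.2 (hle.trans (hn.le.trans (min_le_left _ _)))
  · refine le_liminf_of_le (by isBoundedDefault) ?_
    filter_upwards [Ioo_mem_nhdsGT (zero_lt_one' ℝ)] with ε hε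
    exact_mod_cast div_nonneg_of_nonpos (entNum_nonpos μ ε) (Real.log_nonpos hε.1.le hε.2.le)

/-- Every measure close to a finitely supported measure has small entropy at some small scale. -/
lemma eventually_entNum_div_log_le [CompactSpace X] [OpensMeasurableSpace X]
    (μ₀ : ProbabilityMeasure X) {F : Finset X} (hF : μ₀.toMeasure (F : Set X)ᶜ = 0)
    {δ : ℝ} (hδ : 0 < δ) :
    ∃ ε ∈ Ioo (0 : ℝ) δ, ∀ᶠ μ : ProbabilityMeasure X in 𝓝 μ₀,
      entNum μ.toMeasure ε / Real.log ε ≤ δ := by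
  have hFne : F.Nonempty := by
    rw [Finset.nonempty_iff_ne_empty]
    rintro rfl
    simp at hF
  have hFcard : (1 : ℝ) ≤ F.card := by exact_mod_cast hFne.card_pos
  have hlogF := Real.log_nonneg hFcard
  obtain ⟨ε, ⟨hε0, hε1⟩, hεlog⟩ : ∃ ε ∈ Ioo (0 : ℝ) (min δ 1),
      Real.log F.card + 3 ≤ δ * -Real.log ε := by
    have h1 : ∀ᶠ ε : ℝ in 𝓝[>] 0, ε ∈ Ioo (0 : ℝ) (min δ 1) :=
      Ioo_mem_nhdsGT (lt_min hδ one_pos)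
    have h2 : ∀ᶠ ε : ℝ in 𝓝[>] 0, Real.log ε ≤ -((Real.log F.card + 3) / δ) :=
      Real.tendsto_log_nhdsGT_zero.eventually_le_atBot _
    obtain ⟨ε, h1, h2⟩ := (h1.and h2).exists
    refine ⟨ε, h1, ?_⟩
    have := (div_le_iff₀' hδ).1 (le_neg.1 h2)
    exact this
  refine ⟨ε, ⟨hε0, hε1.trans_le (min_le_left _ _)⟩, ?_⟩
  obtain ⟨C, -, hCfin, hC⟩ := finite_cover_balls_of_compact (isCompact_univ (X := X))
    (half_pos hε0)
  lift C to Finset X using hCfin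
  have hCne : C.Nonempty := by
    obtain ⟨x, -⟩ := hFne
    obtain ⟨c, hc, -⟩ := mem_iUnion₂.1 (hC (mem_univ x))
    exact ⟨c, hc⟩
  have hlogC : 0 ≤ Real.log C.card :=
    Real.log_nonneg (by exact_mod_cast hCne.card_pos)
  set U : Set X := ⋃ c ∈ F, ball c (ε / 2) with hU
  have hUo : IsOpen U := isOpen_biUnion fun _ _ => isOpen_ball
  have hFU : (F : Set X) ⊆ U := fun x hx =>
    mem_iUnion₂.2 ⟨x, hx, mem_ball_self (half_pos hε0)⟩
  have hμ₀U : μ₀.toMeasure U = 1 := (prob_compl_eq_zero_iff hUo.measurableSet).1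
    (measure_mono_null (compl_subset_compl.2 hFU) hF)
  set η : ℝ := (Real.log C.card + 1)⁻¹ with hη
  have hη0 : 0 < η := by positivity
  have hlim : ∀ᶠ μ : ProbabilityMeasure X in 𝓝 μ₀, μ.toMeasure Uᶜ ≤ ENNReal.ofReal η := by
    have h1 := ProbabilityMeasure.le_liminf_measure_open_of_tendsto
      (tendsto_id (x := 𝓝 μ₀)) hUo
    rw [hμ₀U] at h1
    have h2 : 1 - ENNReal.ofReal η < 1 :=
      ENNReal.sub_lt_self ENNReal.one_ne_top one_ne_zero (ENNReal.ofReal_pos.2 hη0).ne'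
    filter_upwards [eventually_lt_of_lt_liminf (h2.trans_le h1)] with μ hμ
    rw [prob_compl_eq_one_sub hUo.measurableSet, tsub_le_iff_right, add_comm]
    exact tsub_le_iff_right.1 hμ.le
  filter_upwards [hlim] with μ hμ
  have hent : -entNum μ.toMeasure ε ≤ Real.log F.card + 3 := by
    refine neg_entNum_le_of_lintegral_le _ (by positivity) ?_
    rw [← lintegral_add_compl _ hUo.measurableSet]
    have h1 := setLIntegral_neg_log_measure_ball_le μ.toMeasure hFne (s := U) (ε := ε) subset_rfl
    have h2 := setLIntegral_neg_log_measure_ball_le μ.toMeasure hCne (s := Uᶜ) (ε := ε)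
      fun x _ => hC (mem_univ x)
    have h3 : ENNReal.ofReal (Real.log F.card) * μ.toMeasure U ≤
        ENNReal.ofReal (Real.log F.card) := mul_le_of_le_one_right' prob_le_one
    have h4 : ENNReal.ofReal (Real.log C.card) * μ.toMeasure Uᶜ ≤ 1 := by
      calc _ ≤ ENNReal.ofReal (Real.log C.card) * ENNReal.ofReal η := by gcongr
        _ = ENNReal.ofReal (Real.log C.card * η) := (ENNReal.ofReal_mul hlogC).symm
        _ ≤ 1 := by
          rw [ENNReal.ofReal_le_one, hη, ← div_eq_mul_inv, div_le_one (by positivity)]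
          linarith
    calc _ ≤ (ENNReal.ofReal (Real.log F.card) + 1) + (1 + 1) :=
          add_le_add (h1.trans (by gcongr)) (h2.trans (by gcongr))
      _ = ENNReal.ofReal (Real.log F.card + 3) := by
          rw [ENNReal.ofReal_add hlogF (by norm_num), add_assoc]
          norm_num
  have hlogε : Real.log ε < 0 := Real.log_neg hε0 (hε1.trans_le (min_le_right _ _))
  rw [div_le_iff_of_neg hlogε]
  linarith

/-- A dense supply of finitely supported measures in a set `S` of probability measures forces the
lower entropy dimension to vanish generically on `S`. -/
lemma D1lower_eq_zero_mem_residual [CompactSpace X] [OpensMeasurableSpace X]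
    (S : Set (ProbabilityMeasure X))
    (hS : Dense {μ : S | ∃ F : Finset X, μ.val.toMeasure (F : Set X)ᶜ = 0}) :
    {μ : S | D1lower μ.val.toMeasure = 0} ∈ residual S := by
  let V : ℕ → Set S := fun n => {μ | ∃ ε ∈ Ioo (0 : ℝ) (1 / (n + 1)),
    entNum μ.val.toMeasure ε / Real.log ε ≤ 1 / ((n : ℝ) + 1)}
  have hV : ∀ n, V n ∈ residual S := fun n => by
    refine mem_of_superset (residual_of_dense_open isOpen_interior (hS.mono ?_)) interior_subset
    rintro μ ⟨F, hF⟩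
    obtain ⟨ε, hε, h⟩ := eventually_entNum_div_log_le μ.val hF
      (show (0 : ℝ) < 1 / (n + 1) by positivity)
    rw [mem_interior_iff_mem_nhds]
    filter_upwards [continuous_subtype_val.continuousAt.eventually h] with ν hν
    exact ⟨ε, hε, hν⟩
  filter_upwards [countable_iInter_mem.2 hV] with μ hμ
  exact D1lower_eq_zero _ fun n => mem_iInter.1 hμ n

end EntropyBound

section ShiftDensity

variable {M : Type*}

lemma exists_forall_dist_lt_of_continuous [MetricSpace M] [CompactSpace M]
    {f : (ℤ → M) → ℝ} (hf : Continuous f)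
    {η : ℝ} (hη : 0 < η) :
    ∃ m : ℕ, ∃ δ > 0, ∀ x y : ℤ → M,
      (∀ j : ℤ, |j| ≤ m → dist (x j) (y j) < δ) → dist (f x) (f y) < η := by
  have huc := CompactSpace.uniformContinuous_of_continuous hf
  have hmem := huc (Metric.dist_mem_uniformity hη)
  rw [mem_map, Pi.uniformity] at hmem
  obtain ⟨⟨I, e⟩, ⟨hI, he⟩, hsub⟩ :=
    (HasBasis.iInf' fun i : ℤ => (Metric.uniformity_basis_dist (α := M)).comap
      fun a : (ℤ → M) × (ℤ → M) => (a.1 i, a.2 i)).mem_iff.1 hmem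
  obtain ⟨m, hm⟩ := (hI.image Int.natAbs).bddAbove
  obtain ⟨δ, hδ, hδ0⟩ : ∃ δ : ℝ, (∀ i ∈ I, δ < e i) ∧ 0 < δ :=
    (((eventually_all_finite hI).2 fun i hi => mem_nhdsWithin_of_mem_nhds
      (Iio_mem_nhds (he i hi))).and (self_mem_nhdsWithin (a := (0 : ℝ)) (s := Ioi 0))).exists
  refine ⟨m, δ, hδ0, fun x y hxy => ?_⟩
  refine @hsub (x, y) (mem_iInter₂.2 fun i hi => ?_)
  have hi' : i.natAbs ≤ m := hm (mem_image_of_mem _ hi)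
  exact (hxy i (by rw [Int.abs_eq_natAbs]; exact_mod_cast hi')).trans (hδ i hi)

/-- The point of period `N` obtained by repeating the block of `x` over `(-N, 0]`, each coordinate
being moved by `p`. -/
def periodize (p : M → M) (N : ℕ) (x : ℤ → M) : ℤ → M :=
  fun j => p (x (-((-j) % (N : ℤ))))

lemma shift_iterate_apply {T : (ℤ → M) → (ℤ → M)} (hT : ∀ x i, T x i = x (i - 1))
    (n : ℕ) (x : ℤ → M) (j : ℤ) : T^[n] x j = x (j - n) := by
  induction n generalizing x with
  | zero => simp
  | succ n ih =>
    rw [Function.iterate_succ_apply, ih, hT]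
    congr 1
    push_cast
    ring

lemma shift_iterate_periodize {T : (ℤ → M) → (ℤ → M)} (hT : ∀ x i, T x i = x (i - 1))
    (p : M → M) (N : ℕ) (x : ℤ → M) : T^[N] (periodize p N x) = periodize p N x := by
  ext j
  rw [shift_iterate_apply hT]
  have h : -(j - (N : ℤ)) = -j + N := by ring
  simp only [periodize, h, Int.add_emod_right]

lemma dist_shift_iterate_periodize_lt [MetricSpace M] {T : (ℤ → M) → (ℤ → M)} (hT : ∀ x i, T x i = x (i - 1))
    {p : M → M} {δ : ℝ} (hp : ∀ y, dist (p y) y < δ) {N m i : ℕ} (hi : m ≤ i) (hiN : i + m < N)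
    (x : ℤ → M) {j : ℤ} (hj : |j| ≤ m) :
    dist (T^[i] (periodize p N x) j) (T^[i] x j) < δ := by
  rw [abs_le] at hj
  rw [shift_iterate_apply hT, shift_iterate_apply hT, periodize, neg_sub,
    Int.emod_eq_of_lt (by omega) (by omega), neg_sub]
  exact hp _

lemma finite_range_periodize {p : M → M} (hp : (range p).Finite) {N : ℕ} (hN : 0 < N) :
    (range (periodize p N)).Finite := by
  have : Finite (range p) := hp
  have hlt : ∀ j : ℤ, ((-j) % (N : ℤ)).toNat < N := fun j => by
    have := Int.emod_lt_of_pos (-j) (show (0 : ℤ) < N by omega)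
    omega
  refine (finite_range fun (g : Fin N → range p) (j : ℤ) =>
    (g ⟨((-j) % (N : ℤ)).toNat, hlt j⟩ : M)).subset ?_
  rintro _ ⟨x, rfl⟩
  refine ⟨fun l => ⟨p (x (-(l : ℤ))), mem_range_self _⟩, ?_⟩
  ext j
  have := Int.emod_nonneg (-j) (show (N : ℤ) ≠ 0 by omega)
  simp only [periodize, Int.toNat_of_nonneg this]

variable [MeasurableSpace M]

lemma measurable_periodize {p : M → M} (hp : Measurable p) (N : ℕ) :
    Measurable (periodize p N) :=
  measurable_pi_iff.2 fun _ => hp.comp (measurable_pi_apply _)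

lemma measurable_shift {T : (ℤ → M) → (ℤ → M)} (hT : ∀ x i, T x i = x (i - 1)) :
    Measurable T :=
  measurable_pi_iff.2 fun i => by simpa only [hT] using measurable_pi_apply (i - 1)

/-- The average over `i < N` of the distributions of `T^i (periodize p N x)`, for `x`
distributed according to `μ`. -/
noncomputable def periodicAverage (T : (ℤ → M) → (ℤ → M)) (p : M → M) (N : ℕ)
    (μ : Measure (ℤ → M)) : Measure (ℤ → M) :=
  (N : ℝ≥0∞)⁻¹ • ∑ i ∈ Finset.range N, μ.map (T^[i] ∘ periodize p N)

lemma isProbabilityMeasure_periodicAverage {T : (ℤ → M) → (ℤ → M)}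
    (hT : ∀ x i, T x i = x (i - 1)) {p : M → M} (hp : Measurable p) {N : ℕ} (hN : 0 < N)
    (μ : Measure (ℤ → M)) [IsProbabilityMeasure μ] :
    IsProbabilityMeasure (periodicAverage T p N μ) := by
  have h : ∀ i, μ.map (T^[i] ∘ periodize p N) univ = 1 := fun i => by
    rw [Measure.map_apply (((measurable_shift hT).iterate i).comp (measurable_periodize hp N))
      MeasurableSet.univ, preimage_univ, measure_univ]
  constructor
  simp only [periodicAverage, Measure.smul_apply, Measure.coe_finsetSum, Finset.sum_apply, h,
    Finset.sum_const, Finset.card_range, nsmul_eq_mul, mul_one, smul_eq_mul]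
  exact ENNReal.inv_mul_cancel (by exact_mod_cast hN.ne') (ENNReal.natCast_ne_top N)

lemma isInvariantMeasure_periodicAverage {T : (ℤ → M) → (ℤ → M)}
    (hT : ∀ x i, T x i = x (i - 1)) {p : M → M} (hp : Measurable p) (N : ℕ)
    (μ : Measure (ℤ → M)) (s : Set (ℤ → M)) (hs : MeasurableSet s) :
    periodicAverage T p N μ (T ⁻¹' s) = periodicAverage T p N μ s := by
  have hmeas : ∀ i, Measurable (T^[i] ∘ periodize p N) := fun i =>
    ((measurable_shift hT).iterate i).comp (measurable_periodize hp N)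
  have hstep : ∀ i, μ.map (T^[i] ∘ periodize p N) (T ⁻¹' s) =
      μ.map (T^[i + 1] ∘ periodize p N) s := fun i => by
    rw [Measure.map_apply (hmeas _) (measurable_shift hT hs), Measure.map_apply (hmeas _) hs,
      Function.iterate_succ']
    rfl
  have hper : T^[N] ∘ periodize p N = T^[0] ∘ periodize p N :=
    funext fun x => shift_iterate_periodize hT p N x
  have hsum : ∑ i ∈ Finset.range N, μ.map (T^[i + 1] ∘ periodize p N) s =
      ∑ i ∈ Finset.range N, μ.map (T^[i] ∘ periodize p N) s := by
    cases N with
    | zero => simp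
    | succ n => rw [Finset.sum_range_succ, hper, Finset.sum_range_succ']
  simp only [periodicAverage, Measure.smul_apply, Measure.coe_finsetSum, Finset.sum_apply, hstep,
    hsum]

lemma exists_finset_periodicAverage_compl_eq_zero [MeasurableSingletonClass M] {T : (ℤ → M) → (ℤ → M)}
    (hT : ∀ x i, T x i = x (i - 1)) {p : M → M} (hp : Measurable p) (hpf : (range p).Finite)
    {N : ℕ} (hN : 0 < N) (μ : Measure (ℤ → M)) :
    ∃ F : Finset (ℤ → M), periodicAverage T p N μ (F : Set (ℤ → M))ᶜ = 0 := by
  have hfin : (⋃ i ∈ Finset.range N, T^[i] '' range (periodize p N)).Finite :=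
    (Finset.range N).finite_toSet.biUnion fun i _ => (finite_range_periodize hpf hN).image _
  refine ⟨hfin.toFinset, ?_⟩
  rw [hfin.coe_toFinset]
  simp only [periodicAverage, Measure.smul_apply, Measure.coe_finsetSum, Finset.sum_apply,
    smul_eq_mul, mul_eq_zero, Finset.sum_eq_zero_iff]
  refine Or.inr fun i hi => ?_
  rw [Measure.map_apply (((measurable_shift hT).iterate i).comp (measurable_periodize hp N))
    hfin.measurableSet.compl, preimage_compl]
  convert measure_empty (μ := μ)
  rw [compl_empty_iff, eq_univ_iff_forall]
  exact fun x => mem_iUnion₂.2 ⟨i, hi, mem_image_of_mem _ (mem_range_self x)⟩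



lemma sum_range_ite_boundary_le (m N : ℕ) {a : ℝ} (ha : 0 ≤ a) :
    ∑ i ∈ Finset.range N, (if m ≤ i ∧ i + m < N then 0 else a) ≤ 2 * m * a := by
  rw [Finset.sum_ite, Finset.sum_const_zero, zero_add, Finset.sum_const, nsmul_eq_mul]
  refine mul_le_mul_of_nonneg_right ?_ ha
  have hsub : {i ∈ Finset.range N | ¬(m ≤ i ∧ i + m < N)} ⊆
      Finset.range m ∪ Finset.Ico (N - m) N := by
    intro i hi
    simp only [Finset.mem_filter, Finset.mem_range, Finset.mem_union, Finset.mem_Ico] at hi ⊢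
    omega
  have h := (Finset.card_le_card hsub).trans (Finset.card_union_le _ _)
  rw [Finset.card_range, Nat.card_Ico] at h
  have h' : ({i ∈ Finset.range N | ¬(m ≤ i ∧ i + m < N)}).card ≤ 2 * m := by omega
  exact_mod_cast h'

lemma abs_integral_periodicAverage_sub_le [MetricSpace M] [CompactSpace M] [BorelSpace M]
    {T : (ℤ → M) → (ℤ → M)} (hT : ∀ x i, T x i = x (i - 1)) {p : M → M} (hp : Measurable p)
    {N m : ℕ} (hN : 0 < N) {δ η C : ℝ} (hη : 0 ≤ η) (hC0 : 0 ≤ C)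
    (hpδ : ∀ y, dist (p y) y < δ)
    (μ : Measure (ℤ → M)) [IsProbabilityMeasure μ] (hμ : IsInvariantMeasure T μ)
    {f : (ℤ → M) → ℝ} (hf : Continuous f) (hC : ∀ x, |f x| ≤ C)
    (hclose : ∀ x y : ℤ → M, (∀ j : ℤ, |j| ≤ m → dist (x j) (y j) < δ) → dist (f x) (f y) < η) :
    |∫ x, f x ∂(periodicAverage T p N μ) - ∫ x, f x ∂μ| ≤ η + 4 * m * C / N := by
  have hTm := measurable_shift hT
  have hmeas : ∀ i, Measurable (T^[i] ∘ periodize p N) := fun i =>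
    (hTm.iterate i).comp (measurable_periodize hp N)
  have hN' : (0 : ℝ) < N := by exact_mod_cast hN
  have hfg : ∀ (ν : Measure (ℤ → M)) [IsFiniteMeasure ν] (g : (ℤ → M) → (ℤ → M)),
      Measurable g → Integrable (fun x => f (g x)) ν := fun ν _ g hg =>
    .of_bound (hf.measurable.comp hg).aestronglyMeasurable C (.of_forall fun x => hC (g x))
  have hpres : MeasurePreserving T μ μ :=
    ⟨hTm, Measure.ext fun s hs => by rw [Measure.map_apply hTm hs, hμ s hs]⟩
  have hμi : ∀ i, ∫ x, f (T^[i] x) ∂μ = ∫ x, f x ∂μ := fun i => by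
    conv_rhs => rw [← (hpres.iterate i).map_eq]
    exact (integral_map (hTm.iterate i).aemeasurable hf.measurable.aestronglyMeasurable).symm
  have hν : ∫ x, f x ∂(periodicAverage T p N μ) =
      (N : ℝ)⁻¹ * ∑ i ∈ Finset.range N, ∫ x, f (T^[i] (periodize p N x)) ∂μ := by
    rw [periodicAverage, integral_smul_measure, integral_finsetSum_measure]
    · simp only [ENNReal.toReal_inv, ENNReal.toReal_natCast, smul_eq_mul]
      congr 1
      exact Finset.sum_congr rfl fun i _ =>
        integral_map (hmeas i).aemeasurable hf.measurable.aestronglyMeasurable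
    · exact fun i _ => hfg _ id measurable_id
  have hμs : ∫ x, f x ∂μ = (N : ℝ)⁻¹ * ∑ i ∈ Finset.range N, ∫ x, f (T^[i] x) ∂μ := by
    simp only [hμi, Finset.sum_const, Finset.card_range, nsmul_eq_mul]
    field_simp
  have hterm : ∀ i ∈ Finset.range N,
      |∫ x, f (T^[i] (periodize p N x)) ∂μ - ∫ x, f (T^[i] x) ∂μ| ≤
        η + (if m ≤ i ∧ i + m < N then 0 else 2 * C) := fun i _ => by
    rw [← integral_sub (f := fun x => f (T^[i] (periodize p N x))) (hfg μ _ (hmeas i))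
      (hfg μ _ (hTm.iterate i))]
    rw [← mul_one (η + _), ← probReal_univ (μ := μ), ← Real.norm_eq_abs]
    refine norm_integral_le_of_norm_le_const (.of_forall fun x => ?_)
    rw [Real.norm_eq_abs]
    split_ifs with h
    · rw [add_zero, ← Real.dist_eq]
      exact (hclose _ _ fun j hj =>
        dist_shift_iterate_periodize_lt hT hpδ h.1 h.2 x hj).le
    · have h1 := hC (T^[i] (periodize p N x))
      have h2 := hC (T^[i] x)
      exact (abs_sub _ _).trans (by linarith)
  rw [hν, hμs, ← mul_sub, ← Finset.sum_sub_distrib, abs_mul, abs_of_pos (inv_pos.2 hN')]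
  have hsum := (Finset.abs_sum_le_sum_abs _ _).trans (Finset.sum_le_sum hterm)
  rw [Finset.sum_add_distrib, Finset.sum_const, Finset.card_range, nsmul_eq_mul] at hsum
  have hb := sum_range_ite_boundary_le m N (show 0 ≤ 2 * C by positivity)
  calc _ ≤ (N : ℝ)⁻¹ * (N * η + 2 * m * (2 * C)) := by gcongr; linarith
    _ = η + 4 * m * C / N := by field_simp; ring

lemma exists_measurable_finite_range_dist_lt [MetricSpace M] [CompactSpace M] [BorelSpace M]
    [Nonempty M] {δ : ℝ} (hδ : 0 < δ) :
    ∃ p : M → M, Measurable p ∧ (range p).Finite ∧ ∀ y, dist (p y) y < δ := by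
  let e := TopologicalSpace.denseSeq M
  have hcov : (univ : Set M) ⊆ ⋃ n, ball (e n) δ := fun y _ => by
    obtain ⟨n, hn⟩ := (TopologicalSpace.denseRange_denseSeq M).exists_dist_lt y hδ
    exact mem_iUnion.2 ⟨n, hn⟩
  obtain ⟨t, ht⟩ := isCompact_univ.elim_finite_subcover _ (fun n => isOpen_ball) hcov
  let p := SimpleFunc.nearestPt e (t.sup id)
  refine ⟨p, p.measurable, p.finite_range, fun y => ?_⟩
  obtain ⟨k, hk, hy⟩ := mem_iUnion₂.1 (ht (mem_univ y))
  have h := SimpleFunc.edist_nearestPt_le e y (Finset.le_sup (f := id) hk)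
  rw [edist_dist, edist_dist, ENNReal.ofReal_le_ofReal_iff dist_nonneg] at h
  exact h.trans_lt (by rwa [dist_comm])

/-- Finitely supported measures are dense among the invariant measures of the full shift. -/
lemma dense_finitely_supported_invSet [MetricSpace M] [CompactSpace M] [BorelSpace M]
    {T : (ℤ → M) → (ℤ → M)} (hT : ∀ x i, T x i = x (i - 1)) :
    Dense {μ : invSet T | ∃ F : Finset (ℤ → M), μ.val.toMeasure (F : Set (ℤ → M))ᶜ = 0} := by
  intro μ
  obtain ⟨x₀⟩ := μ.val.toMeasure.nonempty_of_neZero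
  have : Nonempty M := ⟨x₀ 0⟩
  choose p hpm hpf hpd using fun n : ℕ =>
    exists_measurable_finite_range_dist_lt (M := M) (Nat.one_div_pos_of_nat (α := ℝ) (n := n))
  let ν : ℕ → invSet T := fun n =>
    ⟨⟨periodicAverage T (p n) (n + 1) μ.val.toMeasure,
      isProbabilityMeasure_periodicAverage hT (hpm n) n.succ_pos _⟩,
      isInvariantMeasure_periodicAverage hT (hpm n) _ _⟩
  refine mem_closure_of_tendsto (f := ν) (b := atTop) ?_ (.of_forall fun n =>
    exists_finset_periodicAverage_compl_eq_zero hT (hpm n) (hpf n) n.succ_pos _)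
  rw [tendsto_subtype_rng, ProbabilityMeasure.tendsto_iff_forall_integral_tendsto]
  intro f
  rw [Metric.tendsto_atTop']
  intro κ hκ
  obtain ⟨m, δ, hδ, hclose⟩ := exists_forall_dist_lt_of_continuous f.continuous (half_pos hκ)
  have h1 : Tendsto (fun n : ℕ => 4 * m * ‖f‖ * (1 / ((n : ℝ) + 1))) atTop (𝓝 0) := by
    simpa using tendsto_one_div_add_atTop_nhds_zero_nat.const_mul (4 * m * ‖f‖)
  obtain ⟨n₀, hn₀⟩ := eventually_atTop.1 ((h1.eventually_lt_const (half_pos hκ)).and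
    (tendsto_one_div_add_atTop_nhds_zero_nat.eventually_lt_const hδ))
  refine ⟨n₀, fun n hn => ?_⟩
  obtain ⟨hn1, hn2⟩ := hn₀ n hn.le
  have h := abs_integral_periodicAverage_sub_le hT (hpm n) n.succ_pos (half_pos hκ).le
    (norm_nonneg f) (fun y => (hpd n y).trans hn2) μ.val.toMeasure μ.2 f.continuous
    f.norm_coe_le_norm hclose
  rw [Real.dist_eq]
  refine h.trans_lt ?_
  rw [mul_one_div] at hn1
  push_cast
  linarith

end ShiftDensity

lemma topologicalSpace_eq_induced_of_compact {X Y : Type*} [τ : TopologicalSpace X]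
    [CompactSpace X] [σ : TopologicalSpace Y] [T2Space Y] {f : X → Y} (hf : Continuous f)
    (hinj : Function.Injective f) : τ = σ.induced f :=
  (hf.isClosedEmbedding hinj).eq_induced

/-- The metric `∑ min (1/(n²+1)) (d(xₙ,yₙ))` induces the product topology. -/
lemma toTopologicalSpace_eq_pi {M : Type*} [MetricSpace M] [CompactSpace M]
    (mX : MetricSpace (ℤ → M))
    (hr : ∀ x y : ℤ → M,
      dist x y = ∑' n : ℤ, min (1 / ((n : ℝ) ^ 2 + 1)) (dist (x n) (y n))) :
    (Pi.topologicalSpace : TopologicalSpace (ℤ → M)) =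
      mX.toUniformSpace.toTopologicalSpace := by
  have hsum : Summable fun n : ℤ => 1 / ((n : ℝ) ^ 2 + 1) := by
    refine Summable.of_norm_bounded_eventually
      (Real.summable_one_div_int_pow.2 one_lt_two) ?_
    filter_upwards [eventually_cofinite_ne (0 : ℤ)] with n hn
    have : (0 : ℝ) < (n : ℝ) ^ 2 := by positivity
    rw [Real.norm_of_nonneg (by positivity)]
    gcongr
    linarith
  have hcont : Continuous[Pi.topologicalSpace, mX.toUniformSpace.toTopologicalSpace]
      (id : (ℤ → M) → (ℤ → M)) := by
    refine (@continuous_iff_continuousAt _ _ Pi.topologicalSpace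
      mX.toUniformSpace.toTopologicalSpace _).2 fun x => ?_
    have hd : Continuous fun y : ℤ → M => mX.dist y x := by
      simp only [hr]
      refine continuous_tsum (fun n => by fun_prop) hsum fun n y => ?_
      rw [Real.norm_of_nonneg (le_min (by positivity) dist_nonneg)]
      exact min_le_left _ _
    have h0 := hd.tendsto x
    rw [mX.dist_self] at h0
    exact (@tendsto_iff_dist_tendsto_zero _ _ mX.toPseudoMetricSpace _ _ _).2 h0
  exact (@topologicalSpace_eq_induced_of_compact _ _ Pi.topologicalSpace _
    mX.toUniformSpace.toTopologicalSpace _ _ hcont Function.injective_id).trans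
    (@induced_id _ mX.toUniformSpace.toTopologicalSpace)

lemma D1lower_eq_zero_mem_residual_of_topology_eq {X : Type*} [τ : TopologicalSpace X]
    [CompactSpace X] [mX : MetricSpace X] (hτ : τ = mX.toUniformSpace.toTopologicalSpace)
    [MeasurableSpace X] [OpensMeasurableSpace X] (S : Set (ProbabilityMeasure X))
    (hS : Dense {μ : S | ∃ F : Finset X, μ.val.toMeasure (F : Set X)ᶜ = 0}) :
    {μ : S | D1lower μ.val.toMeasure = 0} ∈ residual S := by
  subst hτ
  exact D1lower_eq_zero_mem_residual S hS

/-- For the full shift on `X = M^ℤ` (with `M` perfect compact metric, `X`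
bearing the metric `r(x,y) = ∑_{n∈ℤ} min (1/(n²+1)) (d(xₙ,yₙ))`), the set
`ED₋ = {μ ∈ M(T) | D⁻_μ(1) = 0}` is residual in `M(T)`. -/
theorem statement4 {M : Type*} [MetricSpace M] [CompactSpace M]
    (hperf : Perfect (Set.univ : Set M))
    [mX : MetricSpace (ℤ → M)]
    (hr : ∀ x y : ℤ → M,
      dist x y = ∑' n : ℤ, min (1 / ((n : ℝ) ^ 2 + 1)) (dist (x n) (y n)))
    [MeasurableSpace (ℤ → M)] [BorelSpace (ℤ → M)]
    (T : (ℤ → M) → (ℤ → M)) (hT : ∀ (x : ℤ → M) (i : ℤ), T x i = x (i - 1)) :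
    {μ : ↥(invSet T) | D1lower μ.val.toMeasure = (0 : EReal)} ∈ residual ↥(invSet T) := by
  rename_i m hm
  let _ : MeasurableSpace M := borel M
  have _ : BorelSpace M := ⟨rfl⟩
  obtain rfl : m = MeasurableSpace.pi :=
    hm.measurable_eq.trans (Pi.borelSpace (X := fun _ : ℤ => M)).measurable_eq.symm
  exact D1lower_eq_zero_mem_residual_of_topology_eq (toTopologicalSpace_eq_pi mX hr) _
    (dense_finitely_supported_invSet hT)
end

section
/- Let X be a compact metric space and let s ∈ (0,1). Then the set D_−* = {μ ∈ M : liminf_{ε→0⁺} log W_μ(s,ε) / ((s−1) log ε) = 0} is a G_δ subset of the space M of Borel probability measures on X with the weak topology. -/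
open MeasureTheory Filter Topology Metric Set
open scoped ENNReal NNReal

section Auxiliary

variable {X : Type*} [MetricSpace X]

lemma fker_eq_max_min {ε : ℝ} (hε : 0 < ε) (x y : X) :
    fker ε x y = max 0 (min 1 (2 - dist x y / ε)) := by
  unfold fker
  split_ifs with h₁ h₂
  · have : dist x y / ε ≤ 1 := (div_le_one hε).2 h₁
    rw [min_eq_left (by linarith), max_eq_right zero_le_one]
  · have h₃ : dist x y / ε ≤ 2 := (div_le_iff₀ hε).2 h₂
    have h₄ : 1 ≤ dist x y / ε := (one_le_div hε).2 (not_le.1 h₁).le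
    rw [min_eq_right (by linarith), max_eq_right (by linarith)]
  · have h₃ : 2 ≤ dist x y / ε := (le_div_iff₀ hε).2 (not_le.1 h₂).le
    rw [max_eq_left ((min_le_right _ _).trans (by linarith))]

lemma fker_nonneg {ε : ℝ} (hε : 0 < ε) (x y : X) : 0 ≤ fker ε x y := by
  rw [fker_eq_max_min hε]
  exact le_max_left _ _

lemma fker_le_one {ε : ℝ} (hε : 0 < ε) (x y : X) : fker ε x y ≤ 1 := by
  rw [fker_eq_max_min hε]
  exact max_le zero_le_one (min_le_left _ _)

lemma continuous_fker {ε : ℝ} (hε : 0 < ε) (x : X) : Continuous (fker ε x) := by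
  rw [show fker ε x = fun y => max 0 (min 1 (2 - dist x y / ε)) from
    funext (fker_eq_max_min hε x)]
  fun_prop

lemma exists_isBallCover [CompactSpace X] {ε : ℝ} (hε : 0 < ε) :
    ∃ G : Finset X, IsBallCover ε G := by
  obtain ⟨t, ht⟩ := isCompact_univ.elim_finite_subcover (fun x : X => ball x ε)
    (fun _ => isOpen_ball) fun x _ => mem_iUnion.2 ⟨x, mem_ball_self hε⟩
  exact ⟨t, univ_subset_iff.1 ht⟩

variable [MeasurableSpace X]

lemma feps_nonneg {ε : ℝ} (hε : 0 < ε) (μ : Measure X) (x : X) : 0 ≤ feps ε μ x :=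
  integral_nonneg (fker_nonneg hε x)

lemma bddBelow_range_sum_feps_rpow {ε : ℝ} (hε : 0 < ε) (μ : Measure X) (s : ℝ) :
    BddBelow (range fun G : {H : Finset X // IsBallCover ε H} =>
      ∑ x ∈ G.val, (feps ε μ x) ^ s) := by
  refine ⟨0, ?_⟩
  rintro _ ⟨G, rfl⟩
  exact Finset.sum_nonneg fun x _ => Real.rpow_nonneg (feps_nonneg hε μ x) s

variable [BorelSpace X] [CompactSpace X]

lemma integrable_fker {ε : ℝ} (hε : 0 < ε) (μ : Measure X) [IsFiniteMeasure μ] (x : X) :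
    Integrable (fker ε x) μ :=
  (continuous_fker hε x).integrable_of_hasCompactSupport (HasCompactSupport.of_compactSpace _)

lemma feps_le_one {ε : ℝ} (hε : 0 < ε) (μ : Measure X) [IsProbabilityMeasure μ] (x : X) :
    feps ε μ x ≤ 1 := by
  calc feps ε μ x ≤ ∫ _, (1 : ℝ) ∂μ :=
        integral_mono (integrable_fker hε μ x) (integrable_const _) (fker_le_one hε x)
    _ = 1 := by simp

lemma one_le_sum_feps {ε : ℝ} (hε : 0 < ε) (μ : Measure X) [IsProbabilityMeasure μ]
    {G : Finset X} (hG : IsBallCover ε G) : 1 ≤ ∑ x ∈ G, feps ε μ x := by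
  unfold feps
  rw [← integral_finsetSum G fun x _ => integrable_fker hε μ x]
  calc (1 : ℝ) = ∫ _, (1 : ℝ) ∂μ := by simp
    _ ≤ _ := integral_mono (integrable_const _)
      (integrable_finsetSum G fun x _ => integrable_fker hε μ x) fun y => ?_
  obtain ⟨x, hx, hy⟩ := mem_iUnion₂.1 (hG.symm ▸ mem_univ y : y ∈ ⋃ x ∈ G, ball x ε)
  have h : fker ε x y = 1 := if_pos (mem_ball'.1 hy).le
  exact h.symm.le.trans
    (Finset.single_le_sum (f := fun x => fker ε x y) (fun x _ => fker_nonneg hε x y) hx)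

lemma one_le_Wfun {ε s : ℝ} (hε : 0 < ε) (hs : s ∈ Ioo (0 : ℝ) 1) (μ : Measure X)
    [IsProbabilityMeasure μ] : 1 ≤ Wfun μ s ε := by
  obtain ⟨G₀, hG₀⟩ := exists_isBallCover (X := X) hε
  have : Nonempty {H : Finset X // IsBallCover ε H} := ⟨⟨G₀, hG₀⟩⟩
  refine le_ciInf fun G => (one_le_sum_feps hε μ G.2).trans (Finset.sum_le_sum fun x _ => ?_)
  exact Real.self_le_rpow_of_le_one (feps_nonneg hε μ x) (feps_le_one hε μ x) hs.2.le

lemma continuous_feps {ε : ℝ} (hε : 0 < ε) (x : X) :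
    Continuous fun μ : ProbabilityMeasure X => feps ε μ.toMeasure x :=
  ProbabilityMeasure.continuous_integral_boundedContinuousFunction
    (BoundedContinuousFunction.mkOfCompact ⟨fker ε x, continuous_fker hε x⟩)

lemma isOpen_setOf_Wfun_lt {ε s : ℝ} (hε : 0 < ε) (hs : 0 < s) (c : ℝ) :
    IsOpen {μ : ProbabilityMeasure X | Wfun μ.toMeasure s ε < c} := by
  obtain ⟨G₀, hG₀⟩ := exists_isBallCover (X := X) hε
  have : Nonempty {H : Finset X // IsBallCover ε H} := ⟨⟨G₀, hG₀⟩⟩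
  have h : {μ : ProbabilityMeasure X | Wfun μ.toMeasure s ε < c} =
      ⋃ G : {H : Finset X // IsBallCover ε H},
        {μ : ProbabilityMeasure X | ∑ x ∈ G.val, (feps ε μ.toMeasure x) ^ s < c} := by
    ext μ
    simp only [mem_ofPred_eq, mem_iUnion, Wfun]
    exact ciInf_lt_iff (bddBelow_range_sum_feps_rpow hε μ.toMeasure s)
  rw [h]
  refine isOpen_iUnion fun G => isOpen_lt ?_ continuous_const
  exact continuous_finsetSum _ fun x _ =>
    (continuous_feps hε x).rpow_const fun _ => Or.inr hs.le

end Auxiliary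

lemma liminf_coe_eq_zero_iff {α : Type*} {l : Filter α} {u : α → ℝ} (hu : ∀ᶠ a in l, 0 ≤ u a) :
    liminf (fun a => (u a : EReal)) l = 0 ↔ ∀ n : ℕ, ∃ᶠ a in l, u a < 1 / ((n : ℝ) + 1) := by
  constructor
  · intro h n
    have hlt : liminf (fun a => (u a : EReal)) l < ((1 / ((n : ℝ) + 1) : ℝ) : EReal) := by
      rw [h]
      exact_mod_cast Nat.one_div_pos_of_nat
    exact (frequently_lt_of_liminf_lt (by isBoundedDefault) hlt).mono fun a ha =>
      EReal.coe_lt_coe_iff.1 ha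
  · intro h
    refine le_antisymm (not_lt.1 fun hlt => ?_)
      (le_liminf_of_le (by isBoundedDefault) (hu.mono fun a ha => EReal.coe_nonneg.2 ha))
    obtain ⟨c, hc₀, hc⟩ := EReal.lt_iff_exists_real_btwn.1 hlt
    obtain ⟨n, hn⟩ := exists_nat_one_div_lt (EReal.coe_pos.1 hc₀)
    refine h n ((eventually_lt_of_lt_liminf hc (by isBoundedDefault)).mono fun a ha => ?_)
    exact not_lt.2 (hn.trans (EReal.coe_lt_coe_iff.1 ha)).le

lemma frequently_nhdsGT_zero_iff {p : ℝ → Prop} :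
    (∃ᶠ ε in 𝓝[>] (0 : ℝ), p ε) ↔ ∀ k : ℕ, ∃ ε ∈ Ioo 0 (1 / ((k : ℝ) + 1)), p ε := by
  rw [(nhdsGT_basis (0 : ℝ)).frequently_iff]
  constructor
  · exact fun h k => h _ Nat.one_div_pos_of_nat
  · intro h a ha
    obtain ⟨k, hk⟩ := exists_nat_one_div_lt ha
    obtain ⟨ε, hε, hp⟩ := h k
    exact ⟨ε, ⟨hε.1, hε.2.trans hk⟩, hp⟩

/-- For a compact metric space `X` and `s ∈ (0,1)`, the set
`D₋* = {μ | liminf_{ε→0⁺} log W_μ(s,ε)/((s-1) log ε) = 0}` is a `G_δ` subset of the space of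
Borel probability measures on `X` with the weak topology. -/
theorem statement12 {X : Type*} [MetricSpace X] [CompactSpace X]
    [MeasurableSpace X] [BorelSpace X] (s : ℝ) (hs : s ∈ Ioo (0 : ℝ) 1) :
    IsGδ {μ : ProbabilityMeasure X |
      liminf (fun ε : ℝ =>
        ((Real.log (Wfun μ.toMeasure s ε) / ((s - 1) * Real.log ε) : ℝ) : EReal))
        (𝓝[>] (0 : ℝ)) = (0 : EReal)} := by
  have key : {μ : ProbabilityMeasure X |
      liminf (fun ε : ℝ =>
        ((Real.log (Wfun μ.toMeasure s ε) / ((s - 1) * Real.log ε) : ℝ) : EReal))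
        (𝓝[>] (0 : ℝ)) = (0 : EReal)} =
      ⋂ (n : ℕ) (k : ℕ), ⋃ ε ∈ Ioo (0 : ℝ) (1 / ((k : ℝ) + 1)),
        {μ : ProbabilityMeasure X | Wfun μ.toMeasure s ε <
          Real.exp (1 / ((n : ℝ) + 1) * ((s - 1) * Real.log ε))} := by
    ext μ
    have hpos : ∀ ε ∈ Ioo (0 : ℝ) 1, 0 < (s - 1) * Real.log ε := fun ε hε =>
      mul_pos_of_neg_of_neg (sub_neg.2 hs.2) (Real.log_neg hε.1 hε.2)
    have hnonneg : ∀ᶠ ε in 𝓝[>] (0 : ℝ),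
        0 ≤ Real.log (Wfun μ.toMeasure s ε) / ((s - 1) * Real.log ε) := by
      filter_upwards [Ioo_mem_nhdsGT (zero_lt_one' ℝ)] with ε hε
      exact div_nonneg (Real.log_nonneg (one_le_Wfun hε.1 hs μ.toMeasure)) (hpos ε hε).le
    rw [mem_ofPred_eq, liminf_coe_eq_zero_iff hnonneg]
    simp only [frequently_nhdsGT_zero_iff, mem_iInter, mem_iUnion, mem_ofPred_eq, exists_prop]
    refine forall_congr' fun n => forall_congr' fun k => exists_congr fun ε =>
      and_congr_right fun hε => ?_
    have hε₁ : ε < 1 := hε.2.trans_le <| by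
      simpa using Nat.one_div_le_one_div (α := ℝ) (Nat.zero_le k)
    rw [div_lt_iff₀ (hpos ε ⟨hε.1, hε₁⟩),
      Real.log_lt_iff_lt_exp (zero_lt_one.trans_le (one_le_Wfun hε.1 hs μ.toMeasure))]
  rw [key]
  exact .iInter fun n => .iInter fun k =>
    (isOpen_biUnion fun ε hε => isOpen_setOf_Wfun_lt hε.1 hs.1 _).isGδ
end
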